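/- Let K be an algebraically closed field of characteristic zero and n ≥ 3. Then rk(x_0x_1(x_2^2 + ⋯ + x_n^2)) = 4(n−1). Moreover, this quartic admits infinitely many Waring decompositions of length 4(n−1): there are infinitely many sets {ℓ_1,...,ℓ_{4(n−1)}} of pairwise non-proportional linear forms whose fourth powers span a subspace containing x_0x_1(x_2^2 + ⋯ + x_n^2). -/

import Mathlib

open MvPolynomial

/-- Apply the iterated partial-derivative operator `∏ i, (∂/∂xᵢ)^(d i)` to `F`. -/
noncomputable def diffOp {K : Type*} [CommSemiring K] {m : ℕ} (d : Fin m →₀ ℕ)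
    (F : MvPolynomial (Fin m) K) : MvPolynomial (Fin m) K :=
  (List.finRange m).foldr (fun i G => (⇑(MvPolynomial.pderiv i))^[d i] G) F

/-- Apolarity action: apply the differential polynomial `δ` (in the dual variables)
to the polynomial `F`. -/
noncomputable def applyDiff {K : Type*} [CommSemiring K] {m : ℕ}
    (δ F : MvPolynomial (Fin m) K) : MvPolynomial (Fin m) K :=
  δ.support.sum fun d => δ.coeff d • diffOp d F

/-- `IsWaringDecomp F d r`: the degree-`d` form `F` lies in the linear span of the
`d`-th powers of `r` linear forms. -/
def IsWaringDecomp {K : Type*} [Field K] {m : ℕ} (F : MvPolynomial (Fin m) K)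
    (d r : ℕ) : Prop :=
  ∃ ℓ : Fin r → MvPolynomial (Fin m) K,
    (∀ j, (ℓ j).IsHomogeneous 1) ∧
    F ∈ Submodule.span K (Set.range fun j => ℓ j ^ d)

/-- The symmetric (Waring) rank of a degree-`d` form. -/
noncomputable def waringRank {K : Type*} [Field K] {m : ℕ}
    (F : MvPolynomial (Fin m) K) (d : ℕ) : ℕ :=
  sInf {r | IsWaringDecomp F d r}

/-- A Waring decomposition of `F` of length `r = L.card`, recorded as a set: a finset
`L` of pairwise non-proportional linear forms whose `d`-th powers span a subspace
containing `F`. -/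
def IsSetWaringDecomp {K : Type*} [Field K] {m : ℕ} (F : MvPolynomial (Fin m) K)
    (d : ℕ) (L : Finset (MvPolynomial (Fin m) K)) : Prop :=
  (∀ ℓ ∈ L, MvPolynomial.IsHomogeneous ℓ 1) ∧
  (∀ ℓ ∈ L, ∀ ℓ' ∈ L, ℓ ≠ ℓ' → ∀ c : K, ℓ ≠ c • ℓ') ∧
  F ∈ Submodule.span K ((fun ℓ => ℓ ^ d) '' ↑L)

/-- `F` has infinitely many essentially different Waring decompositions of length `r`:
the collection of length-`r` decompositions, where two decompositions are identified
when their sets of forms agree up to nonzero scalars (i.e. recorded as sets of lines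
in the space of linear forms), is infinite. -/
def InfinitelyManyDecomps {K : Type*} [Field K] {m : ℕ} (F : MvPolynomial (Fin m) K)
    (d r : ℕ) : Prop :=
  {T : Set (Submodule K (MvPolynomial (Fin m) K)) |
    ∃ L : Finset (MvPolynomial (Fin m) K), L.card = r ∧ IsSetWaringDecomp F d L ∧
      T = (fun ℓ => Submodule.span K {ℓ}) '' ↑L}.Infinite

/-- `∑_{i ≥ t} x_i²`. -/
noncomputable def sumSqFrom (K : Type*) [CommSemiring K] (m t : ℕ) :
    MvPolynomial (Fin m) K :=
  ∑ i ∈ Finset.univ.filter (fun i : Fin m => t ≤ (i : ℕ)), X i ^ 2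

/-- The derivative in the direction `v`, on polynomials in the coordinates. -/
noncomputable def dirDeriv {K : Type*} [Field K] {m : ℕ} (v : Fin m → K) :
    Derivation K (MvPolynomial (Fin m) K) (MvPolynomial (Fin m) K) :=
  mkDerivation K fun i => C (v i)

@[simp]
lemma dirDeriv_X {K : Type*} [Field K] {m : ℕ} (v : Fin m → K) (i : Fin m) :
    dirDeriv v (X i) = C (v i) :=
  mkDerivation_X ..

@[simp]
lemma dirDeriv_two {K : Type*} [Field K] {m : ℕ} (v : Fin m → K) :
    dirDeriv v (2 : MvPolynomial (Fin m) K) = 0 := by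
  rw [← map_ofNat C, derivation_C]

lemma exists_dual_dirDeriv_of_isHomogeneous_one {K : Type*} [Field K] {m : ℕ}
    {ℓ : MvPolynomial (Fin m) K} (h : ℓ.IsHomogeneous 1) :
    ∃ p : Module.Dual K (Fin m → K), ∀ v, dirDeriv v ℓ = C (p v) := by
  rw [← mem_homogeneousSubmodule, homogeneousSubmodule_one_eq_span_X] at h
  induction h using Submodule.span_induction with
  | mem x hx =>
    obtain ⟨i, rfl⟩ := hx
    exact ⟨LinearMap.proj i, fun v => by simp⟩
  | zero => exact ⟨0, fun v => by simp⟩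
  | add x y _ _ hx hy =>
    obtain ⟨p, hp⟩ := hx
    obtain ⟨q, hq⟩ := hy
    exact ⟨p + q, fun v => by simp [hp, hq]⟩
  | smul a x _ hx =>
    obtain ⟨p, hp⟩ := hx
    exact ⟨a • p, fun v => by simp [hp, smul_eq_C_mul]⟩

lemma dirDeriv_four_sum_pow_four {K : Type*} [Field K] {m r : ℕ} (w : Fin r → K)
    {ℓ : Fin r → MvPolynomial (Fin m) K} {p : Fin r → Module.Dual K (Fin m → K)}
    (hp : ∀ j v, dirDeriv v (ℓ j) = C (p j v)) (v₁ v₂ v₃ v₄ : Fin m → K) :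
    dirDeriv v₁ (dirDeriv v₂ (dirDeriv v₃ (dirDeriv v₄ (∑ j, w j • ℓ j ^ 4)))) =
      C (24 * ∑ j, w j * (p j v₁ * p j v₂ * p j v₃ * p j v₄)) := by
  simp only [map_sum, Finset.mul_sum]
  refine Finset.sum_congr rfl fun j _ => ?_
  have step : ∀ v (k : ℕ) (α : K), dirDeriv v (C α * ℓ j ^ (k + 1)) =
      C (α * (k + 1) * p j v) * ℓ j ^ k := fun v k α => by
    simp only [Derivation.leibniz, Derivation.leibniz_pow, hp, smul_eq_mul, derivation_C,
      nsmul_eq_mul, map_mul, map_add, map_natCast, C_1]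
    push_cast
    ring
  rw [smul_eq_C_mul, step, step, step, ← zero_add 1, step, pow_zero, mul_one]
  congr 1
  push_cast
  ring

/-- The lower bound for the number of points whose weighted fourth moments are those of
`x₀x₁(x₂² + ⋯)`: `a`, `b` and `Y` are the `x₀`, `x₁` and remaining coordinates of the points. -/
lemma four_mul_le_of_moments {K : Type*} [Field K] [Infinite K] {N r : ℕ} (w a b : Fin r → K)
    (Y : Fin r → Module.Dual K (Fin N → K)) {κ : K} (hκ : κ ≠ 0)
    (hY : ∀ c d e f, ∑ j, w j * (Y j c * Y j d * Y j e * Y j f) = 0)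
    (haY : ∀ c d e, ∑ j, w j * (a j * Y j c * Y j d * Y j e) = 0)
    (hbY : ∀ c d e, ∑ j, w j * (b j * Y j c * Y j d * Y j e) = 0)
    (haaY : ∀ c d, ∑ j, w j * (a j * a j * Y j c * Y j d) = 0)
    (hbbY : ∀ c d, ∑ j, w j * (b j * b j * Y j c * Y j d) = 0)
    (habY : ∀ c d, ∑ j, w j * (a j * b j * Y j c * Y j d) = κ * (c ⬝ᵥ d)) :
    4 * N ≤ r := by
  obtain ⟨t, ht⟩ := Module.Dual.exists_forall_ne_zero_of_forall_exists
    (fun j : {j // Y j ≠ 0} => Y j) (fun j => by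
      by_contra! h
      exact j.2 (LinearMap.ext h))
  replace ht : ∀ j, Y j t = 0 → Y j = 0 := fun j h => by
    by_contra hj
    exact ht ⟨j, hj⟩ h
  have key : ∀ c : Fin N → K, (∀ d, κ * (c ⬝ᵥ d) = 0) → c = 0 := fun c h => by
    refine dotProduct_eq_zero c fun d => ?_
    exact (mul_eq_zero.1 (h d)).resolve_left hκ
  let Ψ : (Fin 4 → Fin N → K) →ₗ[K] (Fin r → K) := LinearMap.pi fun j =>
    (Y j t ^ 2) • (Y j ∘ₗ LinearMap.proj 0) + (Y j t * a j) • (Y j ∘ₗ LinearMap.proj 1) +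
      (Y j t * b j) • (Y j ∘ₗ LinearMap.proj 2) + (a j * b j) • (Y j ∘ₗ LinearMap.proj 3)
  have hΨ : Function.Injective Ψ := by
    rw [← LinearMap.ker_eq_bot, LinearMap.ker_eq_bot']
    intro c hc
    have h : ∀ j, Y j t ^ 2 * Y j (c 0) + Y j t * a j * Y j (c 1) + Y j t * b j * Y j (c 2) +
        a j * b j * Y j (c 3) = 0 := fun j => congrFun hc j
    have h3 : c 3 = 0 := key _ fun d => by
      rw [← habY]
      have : ∑ j, w j * (a j * b j * Y j (c 3) * Y j d) =
          -(∑ j, w j * (Y j t * Y j t * Y j (c 0) * Y j d))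
          - (∑ j, w j * (a j * Y j t * Y j (c 1) * Y j d))
          - (∑ j, w j * (b j * Y j t * Y j (c 2) * Y j d)) := by
        rw [← Finset.sum_neg_distrib, ← Finset.sum_sub_distrib, ← Finset.sum_sub_distrib]
        exact Finset.sum_congr rfl fun j _ => by linear_combination w j * Y j d * h j
      rw [this, hY, haY, hbY]
      simp
    replace h : ∀ j, Y j t * Y j (c 0) + a j * Y j (c 1) + b j * Y j (c 2) = 0 := fun j => by
      by_cases hj : Y j t = 0
      · simp [ht j hj]
      · refine (mul_eq_zero.1 ?_).resolve_left hj
        have := h j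
        rw [h3, map_zero] at this
        linear_combination this
    have h1 : c 1 = 0 := key _ fun d => by
      rw [← habY]
      have : ∑ j, w j * (a j * b j * Y j (c 1) * Y j d) =
          -(∑ j, w j * (b j * Y j t * Y j (c 0) * Y j d))
          - (∑ j, w j * (b j * b j * Y j (c 2) * Y j d)) := by
        rw [← Finset.sum_neg_distrib, ← Finset.sum_sub_distrib]
        exact Finset.sum_congr rfl fun j _ => by linear_combination w j * b j * Y j d * h j
      rw [this, hbY, hbbY]
      simp
    have h2 : c 2 = 0 := key _ fun d => by
      rw [← habY]
      have : ∑ j, w j * (a j * b j * Y j (c 2) * Y j d) =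
          -(∑ j, w j * (a j * Y j t * Y j (c 0) * Y j d))
          - (∑ j, w j * (a j * a j * Y j (c 1) * Y j d)) := by
        rw [← Finset.sum_neg_distrib, ← Finset.sum_sub_distrib]
        exact Finset.sum_congr rfl fun j _ => by linear_combination w j * a j * Y j d * h j
      rw [this, haY, haaY]
      simp
    have h0 : c 0 = 0 := key _ fun d => by
      rw [← habY]
      refine Finset.sum_eq_zero fun j _ => ?_
      have hj := h j
      rw [h1, h2, map_zero] at hj
      have : Y j (c 0) = 0 := by
        by_cases hjt : Y j t = 0
        · simp [ht j hjt]
        · exact (mul_eq_zero.1 (by linear_combination hj)).resolve_left hjt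
      simp [this]
    funext i
    fin_cases i <;> assumption
  have := LinearMap.finrank_le_finrank_of_injective hΨ
  simpa [Module.finrank_pi_fintype] using this

lemma sumSqFrom_two_eq {K : Type*} [CommSemiring K] (N : ℕ) :
    sumSqFrom K (N + 2) 2 = ∑ k : Fin N, X k.succ.succ ^ 2 := by
  simp [sumSqFrom, Finset.sum_filter, Fin.sum_univ_succ]

lemma four_mul_le_of_isWaringDecomp {K : Type*} [Field K] [CharZero K] {N r : ℕ}
    (h : IsWaringDecomp (X 0 * X 1 * sumSqFrom K (N + 2) 2) 4 r) : 4 * N ≤ r := by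
  obtain ⟨ℓ, hℓ, hF⟩ := h
  obtain ⟨w, hw⟩ := (Submodule.mem_span_range_iff_exists_fun K).1 hF
  choose p hp using fun j => exists_dual_dirDeriv_of_isHomogeneous_one (hℓ j)
  have hmom := dirDeriv_four_sum_pow_four w hp
  rw [hw, sumSqFrom_two_eq] at hmom
  let ι : (Fin N → K) →ₗ[K] (Fin (N + 2) → K) :=
    { toFun := fun c => Fin.cons 0 (Fin.cons 0 c)
      map_add' := fun c d => by
        funext i
        refine Fin.cases ?_ (fun i => Fin.cases ?_ (fun i => ?_) i) i <;> simp
      map_smul' := fun c d => by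
        funext i
        refine Fin.cases ?_ (fun i => Fin.cases ?_ (fun i => ?_) i) i <;> simp }
  have hι0 : ∀ c, ι c 0 = 0 := fun c => rfl
  have hι1 : ∀ c, ι c 1 = 0 := fun c => rfl
  have hι2 : ∀ c k, ι c (Fin.succ (Fin.succ k)) = c k := fun c k => rfl
  let e : Fin (N + 2) → K := Fin.cons 1 0
  let f : Fin (N + 2) → K := Fin.cons 0 (Fin.cons 1 0)
  have he0 : e 0 = 1 := rfl
  have he1 : e 1 = 0 := rfl
  have hf0 : f 0 = 0 := rfl
  have hf1 : f 1 = 1 := rfl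
  have hvan : ∀ v₁ v₂ v₃ v₄ : Fin (N + 2) → K,
      dirDeriv v₁ (dirDeriv v₂ (dirDeriv v₃ (dirDeriv v₄
        (X 0 * X 1 * ∑ k : Fin N, X k.succ.succ ^ 2)))) = 0 →
      ∑ j, w j * (p j v₁ * p j v₂ * p j v₃ * p j v₄) = 0 := fun v₁ v₂ v₃ v₄ h => by
    rw [hmom, C_eq_zero] at h
    exact (mul_eq_zero.1 h).resolve_left (by norm_num)
  refine four_mul_le_of_moments w (fun j => p j e) (fun j => p j f) (fun j => p j ∘ₗ ι)
    (κ := 1 / 12) (by norm_num) (fun c d g h => hvan _ _ _ _ ?_) (fun c d g => hvan _ _ _ _ ?_)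
    (fun c d g => hvan _ _ _ _ ?_) (fun c d => hvan _ _ _ _ ?_) (fun c d => hvan _ _ _ _ ?_)
    (fun c d => ?_)
  · simp [Derivation.leibniz, Derivation.leibniz_pow, hι0, hι1, hι2]
  · simp [Derivation.leibniz, Derivation.leibniz_pow, hι0, hι1, hι2]
  · simp [Derivation.leibniz, Derivation.leibniz_pow, hι0, hι1, hι2]
  · simp [Derivation.leibniz, Derivation.leibniz_pow, hι0, hι1, hι2, he0, he1]
  · simp [Derivation.leibniz, Derivation.leibniz_pow, hι0, hι1, hι2, hf0, hf1]
  have h : dirDeriv e (dirDeriv f (dirDeriv (ι c) (dirDeriv (ι d)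
      (X 0 * X 1 * ∑ k : Fin N, X k.succ.succ ^ 2)))) = C (2 * (c ⬝ᵥ d)) := by
    simp [Derivation.leibniz, Derivation.leibniz_pow, hι0, hι1, hι2, he0, hf0, hf1, dotProduct,
      Finset.mul_sum, mul_comm]
    simp only [map_ofNat]
  rw [hmom, C_inj] at h
  change ∑ j, w j * (p j e * p j f * p j (ι c) * p j (ι d)) = _
  linear_combination (1 / 24) * h

/-- A linear form `d (x₀ + s x₁) + x_{k+2}`. -/
noncomputable def waringForm {K : Type*} [Field K] {N : ℕ} (d s : K) (k : Fin N) :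
    MvPolynomial (Fin (N + 2)) K :=
  C d * (X 0 + C s * X 1) + X k.succ.succ

lemma waringForm_isHomogeneous {K : Type*} [Field K] {N : ℕ} (d s : K) (k : Fin N) :
    (waringForm d s k).IsHomogeneous 1 :=
  (((isHomogeneous_X ..).add ((isHomogeneous_X ..).C_mul _)).C_mul _).add (isHomogeneous_X ..)

lemma eq_of_waringForm_eq_smul {K : Type*} [Field K] {N : ℕ} {d s d' s' κ : K} {k k' : Fin N}
    (hd : d ≠ 0) (h : waringForm d s k = κ • waringForm d' s' k') :
    d = d' ∧ s = s' ∧ k = k' := by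
  have hev : ∀ v : Fin (N + 2) → K, d * (v 0 + s * v 1) + v k.succ.succ =
      κ * (d' * (v 0 + s' * v 1) + v k'.succ.succ) := fun v => by
    simpa only [waringForm, smul_eval, map_add, map_mul, eval_C, eval_X] using congrArg (eval v) h
  have hk : k = k' := by
    by_contra hk
    have hk' : (k' : ℕ) ≠ k := fun h => hk (Fin.ext h.symm)
    simpa [Pi.single_apply, Fin.ext_iff, hk'] using hev (Pi.single k.succ.succ 1)
  subst hk
  have hκ : κ = 1 := by
    simpa [Pi.single_apply, Fin.ext_iff, eq_comm] using hev (Pi.single k.succ.succ 1)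
  subst hκ
  have hdd : d = d' := by
    simpa [Pi.single_apply, Fin.ext_iff] using hev (Pi.single 0 1)
  subst hdd
  have hss : s = s' := by
    simpa [Pi.single_apply, Fin.ext_iff, hd] using hev (Pi.single 1 1)
  exact ⟨rfl, hss, rfl⟩

lemma quartic_eq_sum_waringForm_pow {K : Type*} [Field K] [CharZero K] {N : ℕ} {d : Fin N → K}
    (hd : ∀ k, d k ≠ 0) (hsum : ∑ k, d k ^ 2 = 0) :
    X 0 * X 1 * sumSqFrom K (N + 2) 2 = ∑ k, (1 / (48 * d k ^ 2)) •
      (waringForm (d k) 1 k ^ 4 + waringForm (-d k) 1 k ^ 4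
        - waringForm (d k) (-1) k ^ 4 - waringForm (-d k) (-1) k ^ 4) := by
  have hk : ∀ k, (1 / (48 * d k ^ 2)) •
      (waringForm (d k) 1 k ^ 4 + waringForm (-d k) 1 k ^ 4
        - waringForm (d k) (-1) k ^ 4 - waringForm (-d k) (-1) k ^ 4) =
      C (d k ^ 2) * (C (1 / 24) * ((X 0 + X 1) ^ 4 - (X 0 - X 1) ^ 4)) +
        X 0 * X 1 * X k.succ.succ ^ 2 := fun k => by
    have h1 : (C (1 / (48 * d k ^ 2)) : MvPolynomial (Fin (N + 2)) K) * C (d k) ^ 2 * 48 = 1 := by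
      rw [← map_pow, ← map_ofNat C, ← map_mul, ← map_mul, ← C_1]
      congr 1
      have := hd k
      field_simp
    have h2 : (C (1 / 24) : MvPolynomial (Fin (N + 2)) K) * 24 = 1 := by
      rw [← map_ofNat C, ← map_mul, ← C_1]
      norm_num
    rw [smul_eq_C_mul]
    simp only [waringForm, map_neg, C_1, map_pow]
    linear_combination (X 0 * X 1 * X k.succ.succ ^ 2 +
      C (d k) ^ 2 * C (1 / 24) * ((X 0 + X 1) ^ 4 - (X 0 - X 1) ^ 4)) * h1 -
      2 * C (1 / (48 * d k ^ 2)) * C (d k) ^ 4 * ((X 0 + X 1) ^ 4 - (X 0 - X 1) ^ 4) * h2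
  rw [Finset.sum_congr rfl fun k _ => hk k, Finset.sum_add_distrib, ← Finset.sum_mul,
    ← map_sum, hsum, sumSqFrom_two_eq, Finset.mul_sum]
  simp

lemma exists_sum_sq_eq_zero {K : Type*} [Field K] [IsAlgClosed K] [CharZero K] {N : ℕ}
    (hN : 2 ≤ N) : ∃ c : Fin N → K, (∀ k, c k ≠ 0) ∧ ∑ k, c k ^ 2 = 0 := by
  obtain ⟨M, rfl⟩ := Nat.exists_eq_add_of_le' hN
  obtain ⟨z, hz⟩ := IsAlgClosed.exists_pow_nat_eq (-((M + 1 : ℕ) : K)) (n := 2) (by norm_num)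
  refine ⟨Fin.cons z 1, ?_, ?_⟩
  · refine Fin.cases ?_ fun k => by simp
    rintro (rfl : z = 0)
    have : ((M + 1 : ℕ) : K) = 0 := by linear_combination hz
    exact Nat.cast_ne_zero.2 (Nat.succ_ne_zero M) this
  · rw [Fin.sum_univ_succ]
    simp [hz]

/-- The sign attached to a Boolean. -/
def boolSign (K : Type*) [Field K] (b : Bool) : K := if b then 1 else -1

lemma boolSign_injective (K : Type*) [Field K] [CharZero K] :
    Function.Injective (boolSign K) := by
  have : (1 : K) ≠ -1 := by
    intro h
    have : (2 : K) = 0 := by linear_combination h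
    norm_num at this
  rintro (_ | _) (_ | _) h <;> simp_all [boolSign, eq_comm]

lemma boolSign_ne_zero (K : Type*) [Field K] (b : Bool) : boolSign K b ≠ 0 := by
  cases b <;> simp [boolSign]

/-- The `4N` linear forms `± d k (x₀ ± x₁) + x_{k+2}`. -/
noncomputable def signedForm {K : Type*} [Field K] {N : ℕ} (d : Fin N → K)
    (i : Fin N × Bool × Bool) : MvPolynomial (Fin (N + 2)) K :=
  waringForm (boolSign K i.2.1 * d i.1) (boolSign K i.2.2) i.1

lemma eq_of_signedForm_eq_smul {K : Type*} [Field K] [CharZero K] {N : ℕ} {d : Fin N → K}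
    (hd : ∀ k, d k ≠ 0) {i i' : Fin N × Bool × Bool} {κ : K}
    (h : signedForm d i = κ • signedForm d i') : i = i' := by
  obtain ⟨k, e, s⟩ := i
  obtain ⟨k', e', s'⟩ := i'
  obtain ⟨h1, h2, rfl⟩ :=
    eq_of_waringForm_eq_smul (mul_ne_zero (boolSign_ne_zero K _) (hd _)) h
  obtain rfl : s = s' := boolSign_injective K h2
  obtain rfl : e = e' := boolSign_injective K (mul_right_cancel₀ (hd k) h1)
  rfl

lemma quartic_mem_span_signedForm {K : Type*} [Field K] [CharZero K] {N : ℕ} {d : Fin N → K}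
    (hd : ∀ k, d k ≠ 0) (hsum : ∑ k, d k ^ 2 = 0) :
    X 0 * X 1 * sumSqFrom K (N + 2) 2 ∈
      Submodule.span K (Set.range fun i => signedForm d i ^ 4) := by
  have hmem : ∀ k e s, waringForm (boolSign K e * d k) (boolSign K s) k ^ 4 ∈
      Submodule.span K (Set.range fun i => signedForm d i ^ 4) := fun k e s =>
    Submodule.subset_span ⟨(k, e, s), rfl⟩
  rw [quartic_eq_sum_waringForm_pow hd hsum]
  refine Submodule.sum_mem _ fun k _ => Submodule.smul_mem _ _ ?_
  have h1 := hmem k true true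
  have h2 := hmem k false true
  have h3 := hmem k true false
  have h4 := hmem k false false
  simp only [boolSign, if_true, Bool.false_eq_true, if_false, one_mul, neg_one_mul]
    at h1 h2 h3 h4
  exact Submodule.sub_mem _ (Submodule.sub_mem _ (Submodule.add_mem _ h1 h2) h3) h4

lemma isWaringDecomp_four_mul {K : Type*} [Field K] [IsAlgClosed K] [CharZero K] {N : ℕ}
    (hN : 2 ≤ N) : IsWaringDecomp (X 0 * X 1 * sumSqFrom K (N + 2) 2) 4 (4 * N) := by
  obtain ⟨c, hc, hsum⟩ := exists_sum_sq_eq_zero (K := K) hN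
  have e : Fin (4 * N) ≃ Fin N × Bool × Bool :=
    Fintype.equivOfCardEq (by simp; ring)
  refine ⟨fun j => signedForm c (e j), fun j => waringForm_isHomogeneous .., ?_⟩
  have := quartic_mem_span_signedForm hc hsum
  rwa [← e.surjective.range_comp] at this

lemma infinitelyManyDecomps_four_mul {K : Type*} [Field K] [IsAlgClosed K] [CharZero K] {N : ℕ}
    (hN : 2 ≤ N) :
    InfinitelyManyDecomps (X 0 * X 1 * sumSqFrom K (N + 2) 2) 4 (4 * N) := by
  classical
  obtain ⟨c, hc, hsum⟩ := exists_sum_sq_eq_zero (K := K) hN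
  let d : ℕ → Fin N → K := fun m k => ((m + 1 : ℕ) : K) * c k
  have hd : ∀ m k, d m k ≠ 0 := fun m k =>
    mul_ne_zero (Nat.cast_ne_zero.2 (Nat.succ_ne_zero m)) (hc k)
  have hdsum : ∀ m, ∑ k, d m k ^ 2 = 0 := fun m => by
    simp only [d, mul_pow, ← Finset.mul_sum, hsum, mul_zero]
  have hinj : ∀ m, Function.Injective (signedForm (d m)) := fun m i i' h =>
    eq_of_signedForm_eq_smul (hd m) (κ := 1) (by rw [h, one_smul])
  let L : ℕ → Finset (MvPolynomial (Fin (N + 2)) K) := fun m =>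
    Finset.univ.image (signedForm (d m))
  refine Set.infinite_of_injective_forall_mem
    (f := fun m => (fun ℓ => Submodule.span K {ℓ}) '' (L m : Set (MvPolynomial (Fin (N + 2)) K)))
    ?_ fun m => ⟨L m, ?_, ⟨?_, ?_, ?_⟩, rfl⟩
  · intro m m' h
    have k : Fin N := ⟨0, by omega⟩
    have hmem : Submodule.span K {signedForm (d m) (k, true, true)} ∈
        (fun ℓ => Submodule.span K {ℓ}) '' (L m' : Set (MvPolynomial (Fin (N + 2)) K)) := by
      change _ ∈ (fun m => (fun ℓ => Submodule.span K {ℓ}) ''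
        (L m : Set (MvPolynomial (Fin (N + 2)) K))) m'
      rw [← h]
      exact ⟨_, by simp [L], rfl⟩
    obtain ⟨ℓ, hℓ, hspan⟩ := hmem
    obtain ⟨⟨k', e, s⟩, rfl⟩ : ∃ i, signedForm (d m') i = ℓ := by simpa [L] using hℓ
    have hin : signedForm (d m) (k, true, true) ∈
        Submodule.span K {signedForm (d m') (k', e, s)} := by
      rw [show Submodule.span K {signedForm (d m') (k', e, s)} = _ from hspan]
      exact Submodule.mem_span_singleton_self _
    obtain ⟨κ, hκ⟩ := Submodule.mem_span_singleton.1 hin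
    obtain ⟨h1, -, rfl⟩ :=
      eq_of_waringForm_eq_smul (mul_ne_zero (boolSign_ne_zero K _) (hd _ _)) hκ.symm
    have h2 : ((m + 1 : ℕ) : K) ^ 2 = ((m' + 1 : ℕ) : K) ^ 2 := by
      have h3 : boolSign K true * ((m + 1 : ℕ) : K) = boolSign K e * ((m' + 1 : ℕ) : K) :=
        mul_right_cancel₀ (hc k) (by simpa only [d, mul_assoc] using h1)
      have h4 : ∀ b, boolSign K b ^ 2 = 1 := by rintro (_ | _) <;> simp [boolSign]
      have h5 := congrArg (· ^ 2) h3
      simp only [mul_pow, h4, one_mul] at h5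
      exact h5
    have h3 : (m + 1) ^ 2 = (m' + 1) ^ 2 := by exact_mod_cast h2
    have h4 := Nat.pow_left_injective (n := 2) (by norm_num) h3
    omega
  · rw [Finset.card_image_of_injective _ (hinj m)]
    simp
    ring
  · intro ℓ hℓ
    obtain ⟨i, -, rfl⟩ := Finset.mem_image.1 hℓ
    exact waringForm_isHomogeneous ..
  · intro ℓ hℓ ℓ' hℓ' hne κ h
    obtain ⟨i, -, rfl⟩ := Finset.mem_image.1 hℓ
    obtain ⟨i', -, rfl⟩ := Finset.mem_image.1 hℓ'
    exact hne (congrArg _ (eq_of_signedForm_eq_smul (hd m) h))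
  · have := quartic_mem_span_signedForm (hd m) (hdsum m)
    rwa [Finset.coe_image, Finset.coe_univ, Set.image_univ, ← Set.range_comp]

/-- For `n ≥ 3`, `rk(x₀x₁(x₂² + ⋯ + x_n²)) = 4(n−1)`, and this
quartic admits infinitely many Waring decompositions of length `4(n−1)`. -/
theorem stmt15 (K : Type*) [Field K] [IsAlgClosed K] [CharZero K] (n : ℕ) (hn : 3 ≤ n) :
    waringRank (X 0 * X 1 * sumSqFrom K (n + 1) 2) 4 = 4 * (n - 1) ∧
    InfinitelyManyDecomps (X 0 * X 1 * sumSqFrom K (n + 1) 2) 4 (4 * (n - 1)) := by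
  obtain ⟨N, rfl⟩ : ∃ N, n = N + 1 := ⟨n - 1, by omega⟩
  have hN : 2 ≤ N := by omega
  refine ⟨le_antisymm (Nat.sInf_le (isWaringDecomp_four_mul hN)) ?_,
    infinitelyManyDecomps_four_mul hN⟩
  exact le_csInf ⟨_, isWaringDecomp_four_mul hN⟩ fun r hr => four_mul_le_of_isWaringDecomp hr
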